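/- Let (H, α) be a monoidal Hom-Hopf T-coalgebra over G with bijective antipode, (M, μ) a p-Yetter–Drinfeld module and (N, ν) a q-Yetter–Drinfeld module over (H, α). Endow M ⊗ N with the automorphism μ ⊗ ν, the H_{pq}-action h·(m ⊗ n) = h_{(1,p)}·m ⊗ h_{(2,q)}·n, and the coactions ρ^{M⊗N}_r(m ⊗ n) = m_{(0)} ⊗ n_{(0)} ⊗ n_{(1,r)}π_{q^{-1}}(m_{(1,qrq^{-1})}) for r ∈ G. Then (M ⊗ N, μ ⊗ ν) is a pq-Yetter–Drinfeld module over (H, α). -/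

import Mathlib

open TensorProduct

noncomputable section

section Cast

variable (k : Type*) [Field k] {G : Type*} [Group G] {H : G → Type*}
  [∀ p, AddCommGroup (H p)] [∀ p, Module k (H p)]

/-- Transport of components along an equality of group elements. -/
def cst {a b : G} (h : a = b) : H a →ₗ[k] H b := by subst h; exact LinearMap.id

/-- Transport of components along an equality of group elements, as a linear equivalence. -/
def cstE {a b : G} (h : a = b) : H a ≃ₗ[k] H b := by subst h; exact LinearEquiv.refl k (H a)

end Cast

/-- A (classical) Hopf group-coalgebra over a group `G`. -/
structure HopfGC (k : Type*) [Field k] (G : Type*) [Group G] (H : G → Type*)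
    [∀ p, AddCommGroup (H p)] [∀ p, Module k (H p)] where
  mul : ∀ p : G, H p →ₗ[k] H p →ₗ[k] H p
  one : ∀ p : G, H p
  comul : ∀ p q : G, H (p * q) →ₗ[k] H p ⊗[k] H q
  counit : H (1 : G) →ₗ[k] k
  antipode : ∀ p : G, H p →ₗ[k] H p⁻¹
  mul_assoc' : ∀ (p : G) (a b c : H p), mul p (mul p a b) c = mul p a (mul p b c)
  one_mul' : ∀ (p : G) (a : H p), mul p (one p) a = a
  mul_one' : ∀ (p : G) (a : H p), mul p a (one p) = a
  coassoc : ∀ p q r : G,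
    (TensorProduct.assoc k (H p) (H q) (H r)).toLinearMap.comp
      ((TensorProduct.map (comul p q) LinearMap.id).comp (comul (p * q) r))
    = (TensorProduct.map LinearMap.id (comul q r)).comp
        ((comul p (q * r)).comp (cst k (mul_assoc p q r)))
  counit_comul' : ∀ (p : G) (c : H p),
    (TensorProduct.lid k (H p))
      ((TensorProduct.map counit LinearMap.id) (comul 1 p (cst k (one_mul p).symm c))) = c
  comul_counit' : ∀ (p : G) (c : H p),
    (TensorProduct.rid k (H p))
      ((TensorProduct.map LinearMap.id counit) (comul p 1 (cst k (mul_one p).symm c))) = c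
  comul_mul : ∀ (p q : G) (a b : H (p * q)),
    comul p q (mul (p * q) a b)
      = TensorProduct.map₂ (mul p) (mul q) (comul p q a) (comul p q b)
  comul_one : ∀ p q : G, comul p q (one (p * q)) = (one p) ⊗ₜ[k] (one q)
  counit_mul : ∀ a b : H (1 : G), counit (mul 1 a b) = counit a * counit b
  counit_one : counit (one 1) = 1
  antipode_left : ∀ (p : G) (h : H (1 : G)),
    TensorProduct.lift (mul p)
      ((TensorProduct.map ((cst k (inv_inv p)).comp (antipode p⁻¹)) LinearMap.id)
        (comul p⁻¹ p (cst k (show (1 : G) = p⁻¹ * p by group) h)))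
    = counit h • one p
  antipode_right : ∀ (p : G) (h : H (1 : G)),
    TensorProduct.lift (mul p)
      ((TensorProduct.map LinearMap.id ((cst k (inv_inv p)).comp (antipode p⁻¹)))
        (comul p p⁻¹ (cst k (show (1 : G) = p * p⁻¹ by group) h)))
    = counit h • one p

/-- An automorphism of a Hopf group-coalgebra. -/
structure HopfGCAut {k : Type*} [Field k] {G : Type*} [Group G] {H : G → Type*}
    [∀ p, AddCommGroup (H p)] [∀ p, Module k (H p)] (D : HopfGC k G H) where
  α : ∀ p : G, H p ≃ₗ[k] H p
  map_mul : ∀ (p : G) (a b : H p), α p (D.mul p a b) = D.mul p (α p a) (α p b)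
  map_one : ∀ p : G, α p (D.one p) = D.one p
  map_comul : ∀ (p q : G) (c : H (p * q)),
    TensorProduct.map (α p).toLinearMap (α q).toLinearMap (D.comul p q c)
      = D.comul p q (α (p * q) c)
  map_counit : ∀ c : H (1 : G), D.counit (α 1 c) = D.counit c
  map_antipode : ∀ (p : G) (h : H p), D.antipode p (α p h) = α p⁻¹ (D.antipode p h)

/-- The axioms of a group-cograded monoidal Hom-Hopf algebra, for given structure data. -/
structure IsGCHH (k : Type*) [Field k] {G : Type*} [Group G] {H : G → Type*}
    [∀ p, AddCommGroup (H p)] [∀ p, Module k (H p)]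
    (mul : ∀ p : G, H p →ₗ[k] H p →ₗ[k] H p) (one : ∀ p : G, H p)
    (comul : ∀ p q : G, H (p * q) →ₗ[k] H p ⊗[k] H q) (counit : H (1 : G) →ₗ[k] k)
    (antipode : ∀ p : G, H p →ₗ[k] H p⁻¹) (α : ∀ p : G, H p ≃ₗ[k] H p) : Prop where
  hom_assoc : ∀ (p : G) (a b c : H p), mul p (α p a) (mul p b c) = mul p (mul p a b) (α p c)
  one_mul' : ∀ (p : G) (a : H p), mul p (one p) a = α p a
  mul_one' : ∀ (p : G) (a : H p), mul p a (one p) = α p a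
  α_mul : ∀ (p : G) (a b : H p), α p (mul p a b) = mul p (α p a) (α p b)
  α_one : ∀ p : G, α p (one p) = one p
  hcoassoc : ∀ p q r : G,
    (TensorProduct.map (α p).symm.toLinearMap (comul q r)).comp
      ((comul p (q * r)).comp (cst k (mul_assoc p q r)))
    = (TensorProduct.assoc k (H p) (H q) (H r)).toLinearMap.comp
        ((TensorProduct.map (comul p q) (α r).symm.toLinearMap).comp (comul (p * q) r))
  counit_comul' : ∀ (p : G) (c : H p),
    (TensorProduct.lid k (H p))
      ((TensorProduct.map counit LinearMap.id) (comul 1 p (cst k (one_mul p).symm c)))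
    = (α p).symm c
  comul_counit' : ∀ (p : G) (c : H p),
    (TensorProduct.rid k (H p))
      ((TensorProduct.map LinearMap.id counit) (comul p 1 (cst k (mul_one p).symm c)))
    = (α p).symm c
  comul_αinv : ∀ (p q : G) (c : H (p * q)),
    comul p q ((α (p * q)).symm c)
      = TensorProduct.map (α p).symm.toLinearMap (α q).symm.toLinearMap (comul p q c)
  counit_αinv : ∀ c : H (1 : G), counit ((α 1).symm c) = counit c
  comul_mul : ∀ (p q : G) (a b : H (p * q)),
    comul p q (mul (p * q) a b)
      = TensorProduct.map₂ (mul p) (mul q) (comul p q a) (comul p q b)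
  comul_one : ∀ p q : G, comul p q (one (p * q)) = (one p) ⊗ₜ[k] (one q)
  counit_mul : ∀ a b : H (1 : G), counit (mul 1 a b) = counit a * counit b
  counit_one : counit (one 1) = 1
  antipode_α : ∀ (p : G) (h : H p), antipode p (α p h) = (α p⁻¹) (antipode p h)
  antipode_left : ∀ (p : G) (h : H (1 : G)),
    TensorProduct.lift (mul p)
      ((TensorProduct.map ((cst k (inv_inv p)).comp (antipode p⁻¹)) LinearMap.id)
        (comul p⁻¹ p (cst k (show (1 : G) = p⁻¹ * p by group) h)))
    = counit h • one p
  antipode_right : ∀ (p : G) (h : H (1 : G)),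
    TensorProduct.lift (mul p)
      ((TensorProduct.map LinearMap.id ((cst k (inv_inv p)).comp (antipode p⁻¹)))
        (comul p p⁻¹ (cst k (show (1 : G) = p * p⁻¹ by group) h)))
    = counit h • one p

/-- The axioms of a crossing on a group-cograded (monoidal Hom-)Hopf algebra. -/
structure IsCrossing (k : Type*) [Field k] {G : Type*} [Group G] {H : G → Type*}
    [∀ p, AddCommGroup (H p)] [∀ p, Module k (H p)]
    (mul : ∀ p : G, H p →ₗ[k] H p →ₗ[k] H p) (one : ∀ p : G, H p)
    (comul : ∀ p q : G, H (p * q) →ₗ[k] H p ⊗[k] H q) (counit : H (1 : G) →ₗ[k] k)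
    (α : ∀ p : G, H p ≃ₗ[k] H p)
    (π : ∀ q p : G, H p ≃ₗ[k] H (q * p * q⁻¹)) : Prop where
  π_mul : ∀ (q p : G) (a b : H p),
    π q p (mul p a b) = mul (q * p * q⁻¹) (π q p a) (π q p b)
  π_one : ∀ q p : G, π q p (one p) = one (q * p * q⁻¹)
  π_α : ∀ (q p : G) (a : H p), π q p (α p a) = α (q * p * q⁻¹) (π q p a)
  π_comul : ∀ (q a b : G) (c : H (a * b)),
    TensorProduct.map (π q a).toLinearMap (π q b).toLinearMap (comul a b c)
      = comul (q * a * q⁻¹) (q * b * q⁻¹)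
          (cst k (show q * (a * b) * q⁻¹ = (q * a * q⁻¹) * (q * b * q⁻¹) by group) (π q (a * b) c))
  π_counit : ∀ (q : G) (c : H (1 : G)),
    counit (cst k (show q * (1 : G) * q⁻¹ = 1 by group) (π q 1 c)) = counit c
  π_mult : ∀ (a b p : G) (c : H p),
    cst k (show (a * b) * p * (a * b)⁻¹ = a * (b * p * b⁻¹) * a⁻¹ by group) (π (a * b) p c)
      = π a (b * p * b⁻¹) (π b p c)

/-- A (classical) Hopf `T`-coalgebra: a Hopf group-coalgebra with a crossing. -/
structure HopfTC (k : Type*) [Field k] (G : Type*) [Group G] (H : G → Type*)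
    [∀ p, AddCommGroup (H p)] [∀ p, Module k (H p)] extends HopfGC k G H where
  π : ∀ q p : G, H p ≃ₗ[k] H (q * p * q⁻¹)
  π_mul : ∀ (q p : G) (a b : H p),
    π q p (mul p a b) = mul (q * p * q⁻¹) (π q p a) (π q p b)
  π_one : ∀ q p : G, π q p (one p) = one (q * p * q⁻¹)
  π_comul : ∀ (q a b : G) (c : H (a * b)),
    TensorProduct.map (π q a).toLinearMap (π q b).toLinearMap (comul a b c)
      = comul (q * a * q⁻¹) (q * b * q⁻¹)
          (cst k (show q * (a * b) * q⁻¹ = (q * a * q⁻¹) * (q * b * q⁻¹) by group) (π q (a * b) c))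
  π_counit : ∀ (q : G) (c : H (1 : G)),
    counit (cst k (show q * (1 : G) * q⁻¹ = 1 by group) (π q 1 c)) = counit c
  π_antipode : ∀ (q p : G) (h : H p),
    antipode (q * p * q⁻¹) (π q p h)
      = cst k (show q * p⁻¹ * q⁻¹ = (q * p * q⁻¹)⁻¹ by group) (π q p⁻¹ (antipode p h))
  π_mult : ∀ (a b p : G) (c : H p),
    cst k (show (a * b) * p * (a * b)⁻¹ = a * (b * p * b⁻¹) * a⁻¹ by group) (π (a * b) p c)
      = π a (b * p * b⁻¹) (π b p c)

/-- A group-cograded monoidal Hom-Hopf algebra (bundled data). -/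
structure GCHH (k : Type*) [Field k] (G : Type*) [Group G] (H : G → Type*)
    [∀ p, AddCommGroup (H p)] [∀ p, Module k (H p)] where
  mul : ∀ p : G, H p →ₗ[k] H p →ₗ[k] H p
  one : ∀ p : G, H p
  comul : ∀ p q : G, H (p * q) →ₗ[k] H p ⊗[k] H q
  counit : H (1 : G) →ₗ[k] k
  antipode : ∀ p : G, H p →ₗ[k] H p⁻¹
  α : ∀ p : G, H p ≃ₗ[k] H p
  ax : IsGCHH k mul one comul counit antipode α

/-- A monoidal Hom-Hopf `T`-coalgebra with bijective antipode (bundled data). -/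
structure HomTC (k : Type*) [Field k] (G : Type*) [Group G] (H : G → Type*)
    [∀ p, AddCommGroup (H p)] [∀ p, Module k (H p)] where
  mul : ∀ p : G, H p →ₗ[k] H p →ₗ[k] H p
  one : ∀ p : G, H p
  comul : ∀ p q : G, H (p * q) →ₗ[k] H p ⊗[k] H q
  counit : H (1 : G) →ₗ[k] k
  antipode : ∀ p : G, H p ≃ₗ[k] H p⁻¹
  α : ∀ p : G, H p ≃ₗ[k] H p
  π : ∀ q p : G, H p ≃ₗ[k] H (q * p * q⁻¹)
  ax : IsGCHH k mul one comul counit (fun p => (antipode p).toLinearMap) α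
  cax : IsCrossing k mul one comul counit α π

section YD

variable {k : Type*} [Field k] {G : Type*} [Group G] {H : G → Type*}
  [∀ p, AddCommGroup (H p)] [∀ p, Module k (H p)]

variable (k)

/-- The Yetter-Drinfeld compatibility condition (3) of Definition 4.1. -/
def YDcompat (T : HomTC k G H) (p : G) {M : Type*} [AddCommGroup M] [Module k M]
    (μ : M ≃ₗ[k] M) (act : H p →ₗ[k] M →ₗ[k] M)
    (ρ : ∀ r : G, M →ₗ[k] M ⊗[k] H r) : Prop :=
  ∀ r : G,
    (TensorProduct.map (TensorProduct.lift act) (TensorProduct.lift (T.mul r))).comp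
      ((TensorProduct.tensorTensorTensorComm k (H p) (H r) M (H r)).toLinearMap.comp
        (TensorProduct.map (T.comul p r) (ρ r)))
    =
    (TensorProduct.map μ.toLinearMap (TensorProduct.lift (T.mul r))).comp
      ((TensorProduct.assoc k M (H r) (H r)).toLinearMap.comp
        (((TensorProduct.comm k (H r) (M ⊗[k] H r)).toLinearMap).comp
          ((TensorProduct.map
              ((cst k (show p⁻¹ * (p * r * p⁻¹) * p⁻¹⁻¹ = r by group)).comp
                (T.π p⁻¹ (p * r * p⁻¹)).toLinearMap)
              ((ρ r).comp (TensorProduct.lift act))).comp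
            ((TensorProduct.assoc k (H (p * r * p⁻¹)) (H p) M).toLinearMap.comp
              (TensorProduct.map
                ((T.comul (p * r * p⁻¹) p).comp
                  (cst k (show p * r = (p * r * p⁻¹) * p by group)))
                μ.symm.toLinearMap)))))

/-- The axioms of a (left-right) `p`-Yetter-Drinfeld module over a monoidal Hom-Hopf
`T`-coalgebra. -/
structure IsYD (T : HomTC k G H) (p : G) {M : Type*} [AddCommGroup M] [Module k M]
    (μ : M ≃ₗ[k] M) (act : H p →ₗ[k] M →ₗ[k] M)
    (ρ : ∀ r : G, M →ₗ[k] M ⊗[k] H r) : Prop where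
  act_act : ∀ (a b : H p) (m : M), act (T.α p a) (act b m) = act (T.mul p a b) (μ m)
  act_one : ∀ m : M, act (T.one p) m = μ m
  μ_act : ∀ (a : H p) (m : M), μ (act a m) = act (T.α p a) (μ m)
  ρ_coassoc : ∀ a b : G,
    (TensorProduct.map μ.symm.toLinearMap (T.comul a b)).comp (ρ (a * b))
    = (TensorProduct.assoc k M (H a) (H b)).toLinearMap.comp
        ((TensorProduct.map (ρ a) (T.α b).symm.toLinearMap).comp (ρ b))
  ρ_counit : ∀ m : M,
    (TensorProduct.rid k M) ((TensorProduct.map LinearMap.id T.counit) (ρ 1 m)) = μ.symm m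
  ρ_μ : ∀ r : G,
    (ρ r).comp μ.toLinearMap
      = (TensorProduct.map μ.toLinearMap (T.α r).toLinearMap).comp (ρ r)
  compat : YDcompat k T p μ act ρ

/-- The action of `H (a*b)` on a tensor product of an `H a`-module and an `H b`-module. -/
def tAct (T : HomTC k G H) (a b : G) {M N : Type*} [AddCommGroup M] [Module k M]
    [AddCommGroup N] [Module k N]
    (actM : H a →ₗ[k] M →ₗ[k] M) (actN : H b →ₗ[k] N →ₗ[k] N) :
    H (a * b) →ₗ[k] (M ⊗[k] N) →ₗ[k] (M ⊗[k] N) :=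
  (TensorProduct.map₂ actM actN).comp (T.comul a b)

/-- The coaction on the tensor product `M ⊗ N`, where `N` has degree `b`:
`ρ r (m ⊗ n) = m₍₀₎ ⊗ n₍₀₎ ⊗ n₍₁,r₎ ⬝ π_{b⁻¹}(m₍₁,brb⁻¹₎)`. -/
def tCoact (T : HomTC k G H) (b : G) {M N : Type*} [AddCommGroup M] [Module k M]
    [AddCommGroup N] [Module k N]
    (ρM : ∀ r : G, M →ₗ[k] M ⊗[k] H r) (ρN : ∀ r : G, N →ₗ[k] N ⊗[k] H r) (r : G) :
    (M ⊗[k] N) →ₗ[k] (M ⊗[k] N) ⊗[k] H r :=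
  (TensorProduct.map LinearMap.id
      (TensorProduct.lift (((T.mul r).flip).comp
        ((cst k (show b⁻¹ * (b * r * b⁻¹) * b⁻¹⁻¹ = r by group)).comp
          (T.π b⁻¹ (b * r * b⁻¹)).toLinearMap)))).comp
    ((TensorProduct.tensorTensorTensorComm k M (H (b * r * b⁻¹)) N (H r)).toLinearMap.comp
      (TensorProduct.map (ρM (b * r * b⁻¹)) (ρN r)))

/-- The conjugate action on `ᵠM`: `h ⇀ m = π_{s⁻¹}(h) ⬝ m`. -/
def cAct (T : HomTC k G H) (s p : G) {M : Type*} [AddCommGroup M] [Module k M]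
    (act : H p →ₗ[k] M →ₗ[k] M) : H (s * p * s⁻¹) →ₗ[k] M →ₗ[k] M :=
  act.comp ((cst k (show s⁻¹ * (s * p * s⁻¹) * s⁻¹⁻¹ = p by group)).comp
    (T.π s⁻¹ (s * p * s⁻¹)).toLinearMap)

/-- The conjugate coaction on `ˢM`: `ρ r m = m₍₀₎ ⊗ π_s (m₍₁,s⁻¹rs₎)`. -/
def cCoact (T : HomTC k G H) (s : G) {M : Type*} [AddCommGroup M] [Module k M]
    (ρ : ∀ r : G, M →ₗ[k] M ⊗[k] H r) (r : G) : M →ₗ[k] M ⊗[k] H r :=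
  (TensorProduct.map LinearMap.id
      ((cst k (show s * (s⁻¹ * r * s) * s⁻¹ = r by group)).comp
        (T.π s (s⁻¹ * r * s)).toLinearMap)).comp
    (ρ (s⁻¹ * r * s))

/-- The Hom-associator `(A ⊗ B) ⊗ C ≃ A ⊗ (B ⊗ C)`, `(a ⊗ b) ⊗ c ↦ φA a ⊗ (b ⊗ φC⁻¹ c)`. -/
def homAssoc {A B C : Type*} [AddCommGroup A] [Module k A] [AddCommGroup B] [Module k B]
    [AddCommGroup C] [Module k C] (φA : A ≃ₗ[k] A) (φC : C ≃ₗ[k] C) :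
    (A ⊗[k] B) ⊗[k] C ≃ₗ[k] A ⊗[k] (B ⊗[k] C) :=
  (TensorProduct.assoc k A B C).trans
    (TensorProduct.congr φA (TensorProduct.congr (LinearEquiv.refl k B) φC.symm))

/-- The braiding `c_{M,W} : M ⊗ W → ᴹW ⊗ M`,
`m ⊗ w ↦ (S_{w⁻¹}(m₍₁,w⁻¹₎) ⬝ φW⁻¹ w) ⊗ μ m₍₀₎`, where `W` has degree `w`. -/
def braid (T : HomTC k G H) (w : G) {M W : Type*} [AddCommGroup M] [Module k M]
    [AddCommGroup W] [Module k W] (μ : M ≃ₗ[k] M) (ρM : ∀ r : G, M →ₗ[k] M ⊗[k] H r)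
    (actW : H w →ₗ[k] W →ₗ[k] W) (φW : W ≃ₗ[k] W) : (M ⊗[k] W) →ₗ[k] (W ⊗[k] M) :=
  (TensorProduct.comm k M W).toLinearMap.comp
    ((TensorProduct.map μ.toLinearMap
        (TensorProduct.lift (actW.comp
          ((cst k (inv_inv w)).comp (T.antipode w⁻¹).toLinearMap)))).comp
      ((TensorProduct.assoc k M (H w⁻¹) W).toLinearMap.comp
        (TensorProduct.map (ρM w⁻¹) φW.symm.toLinearMap)))

end YD

/-- The axioms of a monoidal Hom-Hopf algebra on a single space. -/
structure IsMonHomHopf (k : Type*) [Field k] (A : Type*) [AddCommGroup A] [Module k A]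
    (mul : A →ₗ[k] A →ₗ[k] A) (one : A) (comul : A →ₗ[k] A ⊗[k] A) (counit : A →ₗ[k] k)
    (S : A →ₗ[k] A) (α : A ≃ₗ[k] A) : Prop where
  hom_assoc : ∀ a b c : A, mul (α a) (mul b c) = mul (mul a b) (α c)
  one_mul' : ∀ a : A, mul one a = α a
  mul_one' : ∀ a : A, mul a one = α a
  α_mul : ∀ a b : A, α (mul a b) = mul (α a) (α b)
  α_one : α one = one
  hcoassoc :
    (TensorProduct.map α.symm.toLinearMap comul).comp comul
    = (TensorProduct.assoc k A A A).toLinearMap.comp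
        ((TensorProduct.map comul α.symm.toLinearMap).comp comul)
  counit_comul' : ∀ a : A,
    (TensorProduct.lid k A) ((TensorProduct.map counit LinearMap.id) (comul a)) = α.symm a
  comul_counit' : ∀ a : A,
    (TensorProduct.rid k A) ((TensorProduct.map LinearMap.id counit) (comul a)) = α.symm a
  comul_αinv : ∀ a : A,
    comul (α.symm a) = TensorProduct.map α.symm.toLinearMap α.symm.toLinearMap (comul a)
  counit_αinv : ∀ a : A, counit (α.symm a) = counit a
  comul_mul : ∀ a b : A, comul (mul a b) = TensorProduct.map₂ mul mul (comul a) (comul b)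
  comul_one : comul one = one ⊗ₜ[k] one
  counit_mul : ∀ a b : A, counit (mul a b) = counit a * counit b
  counit_one : counit one = 1
  antipode_α : ∀ a : A, S (α a) = α (S a)
  antipode_left : ∀ a : A,
    TensorProduct.lift mul ((TensorProduct.map S LinearMap.id) (comul a)) = counit a • one
  antipode_right : ∀ a : A,
    TensorProduct.lift mul ((TensorProduct.map LinearMap.id S) (comul a)) = counit a • one

section TensorYD

variable {k : Type*} [Field k] {G : Type*} [Group G] {H : G → Type*}
  [∀ p, AddCommGroup (H p)] [∀ p, Module k (H p)]

namespace HomTC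

variable (T : HomTC k G H)

/-- The comultiplication `H c → H a ⊗ H b` for any factorization `c = a * b`. -/
def comulOf {c a b : G} (h : c = a * b) : H c →ₗ[k] H a ⊗[k] H b :=
  (T.comul a b).comp (cst k h)

/-- The crossing `H a → H b` by `s` for any `b` equal to the conjugate of `a` by `s`. -/
def crossOf (s : G) {a b : G} (h : s * a * s⁻¹ = b) : H a →ₗ[k] H b :=
  (cst k h).comp (T.π s a).toLinearMap

theorem comulOf_comulOf {c a b d e f : G} (h₁ : c = a * e) (h₂ : e = b * d) (h₃ : c = f * d)
    (h₄ : f = a * b) (x : H c) :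
    map (T.α a).symm.toLinearMap (T.comulOf h₂) (T.comulOf h₁ x)
      = TensorProduct.assoc k _ _ _
          (map (T.comulOf h₄) (T.α d).symm.toLinearMap (T.comulOf h₃ x)) := by
  subst h₂ h₄ h₃
  exact LinearMap.congr_fun (T.ax.hcoassoc a b d) x

theorem comul_α (a b : G) (x : H (a * b)) :
    T.comul a b (T.α (a * b) x)
      = map (T.α a).toLinearMap (T.α b).toLinearMap (T.comul a b x) := by
  obtain ⟨y, rfl⟩ := (T.α (a * b)).symm.surjective x
  rw [T.ax.comul_αinv, LinearEquiv.apply_symm_apply, ← LinearMap.comp_apply, ← map_comp]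
  simp

variable {s a b : G} (h : s * a * s⁻¹ = b)

theorem crossOf_mul (x y : H a) :
    T.crossOf s h (T.mul a x y) = T.mul b (T.crossOf s h x) (T.crossOf s h y) := by
  subst h; exact T.cax.π_mul s a x y

theorem crossOf_α (x : H a) : T.crossOf s h (T.α a x) = T.α b (T.crossOf s h x) := by
  subst h; exact T.cax.π_α s a x

theorem comulOf_crossOf {s a b a' b' c c' : G} (hc : c = a * b) (ha : s * a * s⁻¹ = a')
    (hb : s * b * s⁻¹ = b') (hh : s * c * s⁻¹ = c') (hc' : c' = a' * b') (x : H c) :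
    T.comulOf hc' (T.crossOf s hh x)
      = map (T.crossOf s ha) (T.crossOf s hb) (T.comulOf hc x) := by
  subst hc ha hb hh
  exact (T.cax.π_comul s a b x).symm

theorem counit_crossOf (s : G) (h : s * 1 * s⁻¹ = 1) (x : H (1 : G)) :
    T.counit (T.crossOf s h x) = T.counit x :=
  T.cax.π_counit s x

theorem crossOf_crossOf {s t u a b c : G} (h₁ : t * a * t⁻¹ = b) (h₂ : s * b * s⁻¹ = c)
    (h₃ : u * a * u⁻¹ = c) (hu : u = s * t) (x : H a) :
    T.crossOf s h₂ (T.crossOf t h₁ x) = T.crossOf u h₃ x := by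
  subst h₁ hu h₂
  exact (T.cax.π_mult s t a x).symm

theorem mul_mul_α (a : G) (x y z : H a) :
    T.mul a (T.mul a ((T.α a).symm x) y) (T.α a z) = T.mul a x (T.mul a y z) := by
  rw [← T.ax.hom_assoc, LinearEquiv.apply_symm_apply]

/-- The map `(m ⊗ x, n ⊗ y) ↦ (m ⊗ n) ⊗ y ⬝ π x` underlying the coaction on `M ⊗ N`. -/
def tensorMul (M N : Type*) [AddCommGroup M] [Module k M] [AddCommGroup N] [Module k N] :
    (M ⊗[k] H a) →ₗ[k] (N ⊗[k] H b) →ₗ[k] (M ⊗[k] N) ⊗[k] H b :=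
  map₂ (TensorProduct.mk k M N) ((T.mul b).flip.comp (T.crossOf s h))

@[simp]
theorem tensorMul_tmul {M N : Type*} [AddCommGroup M] [Module k M] [AddCommGroup N] [Module k N]
    (m : M) (x : H a) (n : N) (y : H b) :
    T.tensorMul h M N (m ⊗ₜ x) (n ⊗ₜ y) = (m ⊗ₜ n) ⊗ₜ T.mul b y (T.crossOf s h x) := rfl

/-- The map `u ⊗ v ↦ μ ((v ⬝ μ⁻¹ m)₍₀₎) ⊗ (v ⬝ μ⁻¹ m)₍₁₎ ⬝ π u`, the right-hand side of the
Yetter-Drinfeld compatibility. -/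
def compatRight {A M : Type*} [AddCommGroup A] [Module k A] [AddCommGroup M] [Module k M]
    (μ : M ≃ₗ[k] M) (act : A →ₗ[k] M →ₗ[k] M) (ρ : M →ₗ[k] M ⊗[k] H b) (m : M) :
    H a ⊗[k] A →ₗ[k] M ⊗[k] H b :=
  lift (((LinearMap.lTensorHom M).comp ((T.mul b).flip.comp (T.crossOf s h))).compl₂
    ((LinearMap.rTensor (H b) μ.toLinearMap).comp (ρ.comp (act.flip (μ.symm m)))))

@[simp]
theorem compatRight_tmul {A M : Type*} [AddCommGroup A] [Module k A] [AddCommGroup M]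
    [Module k M] (μ : M ≃ₗ[k] M) (act : A →ₗ[k] M →ₗ[k] M) (ρ : M →ₗ[k] M ⊗[k] H b) (m : M)
    (u : H a) (v : A) :
    T.compatRight h μ act ρ m (u ⊗ₜ v)
      = LinearMap.lTensor M ((T.mul b).flip (T.crossOf s h u))
          (LinearMap.rTensor (H b) μ.toLinearMap (ρ (act v (μ.symm m)))) := rfl

theorem compatRight_zero {A M : Type*} [AddCommGroup A] [Module k A] [AddCommGroup M]
    [Module k M] (μ : M ≃ₗ[k] M) (act : A →ₗ[k] M →ₗ[k] M) (ρ : M →ₗ[k] M ⊗[k] H b) :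
    T.compatRight h μ act ρ 0 = 0 := by
  ext u v
  simp

theorem compatRight_add {A M : Type*} [AddCommGroup A] [Module k A] [AddCommGroup M]
    [Module k M] (μ : M ≃ₗ[k] M) (act : A →ₗ[k] M →ₗ[k] M) (ρ : M →ₗ[k] M ⊗[k] H b) (m m' : M) :
    T.compatRight h μ act ρ (m + m')
      = T.compatRight h μ act ρ m + T.compatRight h μ act ρ m' := by
  ext u v
  simp

end HomTC

theorem ydCompat_iff {T : HomTC k G H} {p : G} {M : Type*} [AddCommGroup M] [Module k M]
    {μ : M ≃ₗ[k] M} {act : H p →ₗ[k] M →ₗ[k] M} {ρ : ∀ r : G, M →ₗ[k] M ⊗[k] H r} :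
    YDcompat k T p μ act ρ ↔
      ∀ (r s c : G) (h₁ : c = p * r) (h₂ : c = s * p) (h₃ : p⁻¹ * s * p⁻¹⁻¹ = r) (x : H c) (m : M),
        map₂ act (T.mul r) (T.comulOf h₁ x) (ρ r m)
          = T.compatRight h₃ μ act (ρ r) m (T.comulOf h₂ x) := by
  have left (r : G) (w : H p ⊗[k] H r) (z : M ⊗[k] H r) :
      map (lift act) (lift (T.mul r)) (tensorTensorTensorComm k (H p) (H r) M (H r) (w ⊗ₜ z))
        = map₂ act (T.mul r) w z := by
    induction w with
    | zero => simp
    | add w w' hw hw' => simp only [add_tmul, map_add, hw, hw', LinearMap.add_apply]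
    | tmul a b =>
      induction z with
      | zero => simp
      | add z z' hz hz' => simp only [tmul_add, map_add, hz, hz']
      | tmul m y => simp
  have right (r : G) (h₃ : p⁻¹ * (p * r * p⁻¹) * p⁻¹⁻¹ = r) (w : H (p * r * p⁻¹) ⊗[k] H p)
      (m : M) :
      map μ.toLinearMap (lift (T.mul r)) (TensorProduct.assoc k M (H r) (H r)
        (TensorProduct.comm k (H r) (M ⊗[k] H r)
          (map ((cst k h₃).comp (T.π p⁻¹ (p * r * p⁻¹)).toLinearMap) ((ρ r).comp (lift act))
            (TensorProduct.assoc k (H (p * r * p⁻¹)) (H p) M (w ⊗ₜ μ.symm m)))))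
        = T.compatRight h₃ μ act (ρ r) m w := by
    induction w with
    | zero => simp
    | add w w' hw hw' => simp only [add_tmul, map_add, hw, hw']
    | tmul u v =>
      simp only [assoc_tmul, map_tmul, LinearMap.comp_apply, lift.tmul, comm_tmul,
        HomTC.compatRight_tmul]
      generalize ρ r (act v (μ.symm m)) = z
      induction z with
      | zero => simp
      | add z z' hz hz' => simp only [add_tmul, map_add, hz, hz']
      | tmul m y => simp [HomTC.crossOf]
  constructor
  · intro hc r s c h₁ h₂ h₃ x m
    obtain rfl : s = p * r * p⁻¹ := by rw [← h₃]; group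
    subst h₁
    have := LinearMap.congr_fun (hc r) (x ⊗ₜ m)
    simp only [LinearMap.comp_apply, map_tmul, LinearEquiv.coe_coe] at this
    rw [left] at this
    exact this.trans (right r h₃ _ m)
  · intro hc r
    refine TensorProduct.ext' fun x m => ?_
    have := hc r (p * r * p⁻¹) (p * r) rfl (by group) (by group) x m
    simp only [LinearMap.comp_apply, map_tmul, LinearEquiv.coe_coe]
    rw [left]
    exact this.trans (right r _ _ m).symm

section TensorProduct

variable {T : HomTC k G H} {p q : G} {M N : Type*} [AddCommGroup M] [Module k M]
  [AddCommGroup N] [Module k N] {μ : M ≃ₗ[k] M} {actM : H p →ₗ[k] M →ₗ[k] M}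
  {ρM : ∀ r : G, M →ₗ[k] M ⊗[k] H r} {ν : N ≃ₗ[k] N} {actN : H q →ₗ[k] N →ₗ[k] N}
  {ρN : ∀ r : G, N →ₗ[k] N ⊗[k] H r}

theorem tCoact_tmul {r s : G} (h : q⁻¹ * s * q⁻¹⁻¹ = r) (m : M) (n : N) :
    tCoact k T q ρM ρN r (m ⊗ₜ n) = T.tensorMul h M N (ρM s m) (ρN r n) := by
  obtain rfl : s = q * r * q⁻¹ := by rw [← h]; group
  simp only [tCoact, LinearMap.comp_apply, map_tmul]
  generalize ρM (q * r * q⁻¹) m = x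
  generalize ρN r n = y
  induction x with
  | zero => simp
  | add x x' hx hx' => simp only [add_tmul, map_add, LinearMap.add_apply, hx, hx']
  | tmul m x =>
    induction y with
    | zero => simp
    | add y y' hy hy' => simp only [tmul_add, map_add, hy, hy']
    | tmul n y => simp [HomTC.crossOf]

theorem tAct_tAct (hM : IsYD k T p μ actM ρM) (hN : IsYD k T q ν actN ρN) (a b : H (p * q))
    (x : M ⊗[k] N) :
    tAct k T p q actM actN (T.α (p * q) a) (tAct k T p q actM actN b x)
      = tAct k T p q actM actN (T.mul (p * q) a b) (congr μ ν x) := by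
  simp only [tAct, LinearMap.comp_apply, T.comul_α, T.ax.comul_mul]
  generalize T.comul p q a = u
  generalize T.comul p q b = v
  induction x with
  | zero => simp
  | add x x' hx hx' => simp only [map_add, hx, hx']
  | tmul m n =>
    induction u with
    | zero => simp
    | add u u' hu hu' => simp only [map_add, LinearMap.add_apply, hu, hu']
    | tmul a b =>
      induction v with
      | zero => simp
      | add v v' hv hv' => simp only [map_add, LinearMap.add_apply, hv, hv']
      | tmul c d => simp [hM.act_act, hN.act_act]

theorem tAct_one (hM : IsYD k T p μ actM ρM) (hN : IsYD k T q ν actN ρN) (x : M ⊗[k] N) :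
    tAct k T p q actM actN (T.one (p * q)) x = congr μ ν x := by
  simp only [tAct, LinearMap.comp_apply, T.ax.comul_one]
  induction x with
  | zero => simp
  | add x x' hx hx' => simp only [map_add, hx, hx']
  | tmul m n => simp [hM.act_one, hN.act_one]

theorem congr_tAct (hM : IsYD k T p μ actM ρM) (hN : IsYD k T q ν actN ρN) (a : H (p * q))
    (x : M ⊗[k] N) :
    congr μ ν (tAct k T p q actM actN a x)
      = tAct k T p q actM actN (T.α (p * q) a) (congr μ ν x) := by
  simp only [tAct, LinearMap.comp_apply, T.comul_α]
  generalize T.comul p q a = u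
  induction x with
  | zero => simp
  | add x x' hx hx' => simp only [map_add, hx, hx']
  | tmul m n =>
    induction u with
    | zero => simp
    | add u u' hu hu' => simp only [map_add, LinearMap.add_apply, hu, hu']
    | tmul a b => simp [hM.μ_act, hN.μ_act]

theorem tCoact_counit (hM : IsYD k T p μ actM ρM) (hN : IsYD k T q ν actN ρN) (x : M ⊗[k] N) :
    TensorProduct.rid k (M ⊗[k] N) (map LinearMap.id T.counit (tCoact k T q ρM ρN 1 x))
      = (congr μ ν).symm x := by
  induction x with
  | zero => simp
  | add x x' hx hx' => simp only [map_add, hx, hx']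
  | tmul m n =>
    rw [tCoact_tmul (s := 1) (by group), congr_symm_tmul, ← hM.ρ_counit, ← hN.ρ_counit]
    generalize ρM 1 m = x
    generalize ρN 1 n = y
    induction x with
    | zero => simp
    | add x x' hx hx' => simp only [map_add, LinearMap.add_apply, hx, hx', add_tmul]
    | tmul m x =>
      induction y with
      | zero => simp
      | add y y' hy hy' => simp only [map_add, hy, hy', tmul_add]
      | tmul n y => simp [T.ax.counit_mul, T.counit_crossOf, mul_smul, tmul_smul, smul_tmul']

theorem tCoact_congr (hM : IsYD k T p μ actM ρM) (hN : IsYD k T q ν actN ρN) (r : G)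
    (x : M ⊗[k] N) :
    tCoact k T q ρM ρN r (congr μ ν x)
      = map (congr μ ν).toLinearMap (T.α r).toLinearMap (tCoact k T q ρM ρN r x) := by
  induction x with
  | zero => simp
  | add x x' hx hx' => simp only [map_add, hx, hx']
  | tmul m n =>
    have h : q⁻¹ * (q * r * q⁻¹) * q⁻¹⁻¹ = r := by group
    have h₁ := LinearMap.congr_fun (hM.ρ_μ (q * r * q⁻¹)) m
    have h₂ := LinearMap.congr_fun (hN.ρ_μ r) n
    simp only [LinearMap.comp_apply, LinearEquiv.coe_coe] at h₁ h₂
    rw [congr_tmul, tCoact_tmul h, tCoact_tmul h, h₁, h₂]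
    generalize ρM _ m = x
    generalize ρN r n = y
    induction x with
    | zero => simp
    | add x x' hx hx' => simp only [map_add, LinearMap.add_apply, hx, hx']
    | tmul m x =>
      induction y with
      | zero => simp
      | add y y' hy hy' => simp only [map_add, hy, hy']
      | tmul n y => simp [T.ax.α_mul, T.crossOf_α]

theorem tCoact_coassoc (hM : IsYD k T p μ actM ρM) (hN : IsYD k T q ν actN ρN) (a b : G)
    (x : M ⊗[k] N) :
    map (congr μ ν).symm.toLinearMap (T.comul a b) (tCoact k T q ρM ρN (a * b) x)
      = TensorProduct.assoc k _ _ _ (map (tCoact k T q ρM ρN a) (T.α b).symm.toLinearMap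
          (tCoact k T q ρM ρN b x)) := by
  induction x with
  | zero => simp
  | add x x' hx hx' => simp only [map_add, hx, hx']
  | tmul m n =>
    have ha : q⁻¹ * (q * a * q⁻¹) * q⁻¹⁻¹ = a := by group
    have hb : q⁻¹ * (q * b * q⁻¹) * q⁻¹⁻¹ = b := by group
    have hab : q⁻¹ * ((q * a * q⁻¹) * (q * b * q⁻¹)) * q⁻¹⁻¹ = a * b := by group
    generalize q * a * q⁻¹ = s at ha hab
    generalize q * b * q⁻¹ = t at hb hab
    let Φ : M ⊗[k] (H s ⊗[k] H t) →ₗ[k] N ⊗[k] (H a ⊗[k] H b) →ₗ[k]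
        (M ⊗[k] N) ⊗[k] (H a ⊗[k] H b) :=
      map₂ (TensorProduct.mk k M N) ((map₂ (T.mul a) (T.mul b)).flip.comp
        (map (T.crossOf q⁻¹ ha) (T.crossOf q⁻¹ hb)))
    have comul_tensorMul (X : M ⊗[k] H (s * t)) (Y : N ⊗[k] H (a * b)) :
        map (congr μ ν).symm.toLinearMap (T.comul a b) (T.tensorMul hab M N X Y)
          = Φ (map μ.symm.toLinearMap (T.comul s t) X)
              (map ν.symm.toLinearMap (T.comul a b) Y) := by
      induction X with
      | zero => simp
      | add x x' hx hx' => simp only [map_add, LinearMap.add_apply, hx, hx']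
      | tmul m x =>
        induction Y with
        | zero => simp
        | add y y' hy hy' => simp only [map_add, hy, hy']
        | tmul n y =>
          have := T.comulOf_crossOf rfl ha hb hab rfl x
          simp only [T.tensorMul_tmul, map_tmul, LinearEquiv.coe_coe, congr_symm_tmul,
            T.ax.comul_mul, Φ, map₂_apply_tmul, mk_apply, LinearMap.comp_apply,
            LinearMap.flip_apply]
          exact congrArg (fun z => _ ⊗ₜ map₂ (T.mul a) (T.mul b) (T.comul a b y) z) this
    have h₁ := LinearMap.congr_fun (hM.ρ_coassoc s t) m
    have h₂ := LinearMap.congr_fun (hN.ρ_coassoc a b) n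
    simp only [LinearMap.comp_apply, LinearEquiv.coe_coe] at h₁ h₂
    rw [tCoact_tmul hab, tCoact_tmul hb, comul_tensorMul, h₁, h₂]
    generalize ρM t m = x
    generalize ρN b n = y
    induction x with
    | zero => simp
    | add x x' hx hx' => simp only [map_add, LinearMap.add_apply, hx, hx']
    | tmul m x =>
      induction y with
      | zero => simp
      | add y y' hy hy' => simp only [map_add, hy, hy']
      | tmul n y =>
        have α_symm_mul : (T.α b).symm (T.mul b y (T.crossOf q⁻¹ hb x))
            = T.mul b ((T.α b).symm y) (T.crossOf q⁻¹ hb ((T.α t).symm x)) := by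
          rw [LinearEquiv.symm_apply_eq, T.ax.α_mul, ← T.crossOf_α]
          simp
        simp only [map_tmul, T.tensorMul_tmul, tCoact_tmul ha, LinearEquiv.coe_coe, α_symm_mul]
        generalize ρM s m = X
        generalize ρN a n = Y
        induction X with
        | zero => simp
        | add x x' hx hx' => simp only [map_add, add_tmul, LinearMap.add_apply, hx, hx']
        | tmul m x =>
          induction Y with
          | zero => simp
          | add y y' hy hy' => simp only [map_add, add_tmul, hy, hy']
          | tmul n y => simp [Φ]

theorem IsYD.act_α_symm {p : G} {M : Type*} [AddCommGroup M] [Module k M] {μ : M ≃ₗ[k] M}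
    {act : H p →ₗ[k] M →ₗ[k] M} {ρ : ∀ r : G, M →ₗ[k] M ⊗[k] H r} (hM : IsYD k T p μ act ρ)
    (a : H p) (m : M) : act ((T.α p).symm a) (μ.symm m) = μ.symm (act a m) := by
  rw [LinearEquiv.eq_symm_apply, hM.μ_act]; simp

theorem IsYD.ρ_μ_symm {p : G} {M : Type*} [AddCommGroup M] [Module k M] {μ : M ≃ₗ[k] M}
    {act : H p →ₗ[k] M →ₗ[k] M} {ρ : ∀ r : G, M →ₗ[k] M ⊗[k] H r} (hM : IsYD k T p μ act ρ)
    (r : G) (m : M) :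
    ρ r (μ.symm m) = map μ.symm.toLinearMap (T.α r).symm.toLinearMap (ρ r m) := by
  obtain ⟨m, rfl⟩ := μ.surjective m
  have := LinearMap.congr_fun (hM.ρ_μ r) m
  simp only [LinearMap.comp_apply, LinearEquiv.coe_coe] at this
  rw [this, LinearEquiv.symm_apply_apply, ← LinearMap.comp_apply, ← map_comp]
  simp

/-- The left-hand side of the compatibility for `M ⊗ N`, rewritten through the compatibility for
`N` and the coassociativity. -/
theorem map₂_tAct_comulOf (hN : IsYD k T q ν actN ρN) {r s c d : G}
    (hc : c = p * q * r) (hd : c = d * q) (hps : d = p * s) (hs : q⁻¹ * s * q⁻¹⁻¹ = r) (x : H c)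
    (X : M ⊗[k] H s) (n : N) :
    map₂ (tAct k T p q actM actN) (T.mul r) (T.comulOf hc x) (T.tensorMul hs M N X (ρN r n))
      = lift ((T.tensorMul hs M N).compl₁₂
            ((map₂ actM (T.mul s)).flip X ∘ₗ T.comulOf hps)
            (ρN r ∘ₗ actN.flip n)) (T.comulOf hd x) := by
  have hqr : q * r = s * q := by rw [← hs]; group
  have hpqr : c = p * (q * r) := by rw [hc, mul_assoc]
  let Ψ : H p →ₗ[k] (N ⊗[k] H r) →ₗ[k] (M ⊗[k] N) ⊗[k] H r :=
    (T.tensorMul hs M N).comp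
      (((LinearMap.rTensorHom (H s)).comp actM).flip (LinearMap.lTensor M (T.α s).toLinearMap X)
        : H p →ₗ[k] M ⊗[k] H s)
  have assoc_left (v : H (p * q) ⊗[k] H r) (Y : N ⊗[k] H r) :
      map₂ (tAct k T p q actM actN) (T.mul r) v (T.tensorMul hs M N X Y)
        = lift (Ψ.compl₂ ((map₂ actN (T.mul r)).flip Y)) (TensorProduct.assoc k _ _ _
            (map (T.comul p q) (T.α r).symm.toLinearMap v)) := by
    induction v with
    | zero => simp
    | add v v' hv hv' => simp only [map_add, LinearMap.add_apply, hv, hv']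
    | tmul a c =>
      simp only [map_tmul, LinearEquiv.coe_coe, Ψ]
      simp only [map₂_apply_tmul, tAct, LinearMap.comp_apply]
      generalize T.comul p q a = w
      induction w with
      | zero => simp
      | add w w' hw hw' =>
        simp only [map_add, add_tmul, map_add_left, LinearMap.add_apply, hw, hw']
      | tmul a b =>
        simp only [assoc_tmul, lift.tmul, LinearMap.compl₂_apply, LinearMap.comp_apply,
          LinearMap.flip_apply]
        induction X with
        | zero => simp
        | add x x' hx hx' => simp only [map_add, LinearMap.add_apply, hx, hx']
        | tmul m x =>
          induction Y with
          | zero => simp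
          | add y y' hy hy' => simp only [map_add, hy, hy']
          | tmul n y => simp [T.crossOf_α, T.mul_mul_α]
  have compat_N (v : H p ⊗[k] H (q * r)) :
      lift (Ψ.compl₂ ((map₂ actN (T.mul r)).flip (ρN r n)))
          (map (T.α p).symm.toLinearMap (T.comulOf rfl) v)
        = lift (Ψ.compl₂ (T.compatRight hs ν actN (ρN r) n))
          (map (T.α p).symm.toLinearMap (T.comulOf hqr) v) := by
    induction v with
    | zero => simp
    | add v v' hv hv' => simp only [map_add, hv, hv']
    | tmul a b => simp [ydCompat_iff.1 hN.compat r s (q * r) rfl hqr hs b n]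
  have assoc_right (v : H d ⊗[k] H q) :
      lift (Ψ.compl₂ (T.compatRight hs ν actN (ρN r) n)) (TensorProduct.assoc k _ _ _
            (map (T.comulOf hps) (T.α q).symm.toLinearMap v))
        = lift ((T.tensorMul hs M N).compl₁₂ ((map₂ actM (T.mul s)).flip X ∘ₗ T.comulOf hps)
            (ρN r ∘ₗ actN.flip n)) v := by
    induction v with
    | zero => simp
    | add v v' hv hv' => simp only [map_add, hv, hv']
    | tmul a b =>
      simp only [map_tmul, LinearEquiv.coe_coe, lift.tmul, LinearMap.compl₁₂_apply,
        LinearMap.comp_apply, LinearMap.flip_apply, Ψ]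
      generalize T.comulOf hps a = w
      induction w with
      | zero => simp
      | add w w' hw hw' => simp only [map_add, add_tmul, LinearMap.add_apply, hw, hw']
      | tmul a u =>
        simp only [assoc_tmul, lift.tmul, LinearMap.compl₂_apply, T.compatRight_tmul,
          hN.act_α_symm, hN.ρ_μ_symm, LinearMap.comp_apply, LinearMap.flip_apply]
        generalize ρN r (actN b n) = Y
        clear assoc_left compat_N Ψ
        induction X with
        | zero => simp
        | add x x' hx hx' => simp only [map_add, LinearMap.add_apply, hx, hx']
        | tmul m x =>
          induction Y with
          | zero => simp
          | add y y' hy hy' => simp only [map_add, hy, hy']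
          | tmul n y => simp [T.crossOf_α, T.mul_mul_α, T.crossOf_mul]
  rw [assoc_left, ← assoc_right]
  exact (congrArg _ (T.comulOf_comulOf hpqr rfl hc rfl x).symm).trans
    ((compat_N _).trans (congrArg _ (T.comulOf_comulOf hpqr hqr hd hps x)))

/-- The right-hand side of the compatibility for `M ⊗ N`, rewritten through the
coassociativity. -/
theorem compatRight_tAct_comulOf (hN : IsYD k T q ν actN ρN)
    {r s t c d : G} (hc : c = t * (p * q)) (hd : c = d * q) (htp : d = t * p)
    (hs : q⁻¹ * s * q⁻¹⁻¹ = r) (ht : p⁻¹ * t * p⁻¹⁻¹ = s) (htr : (p * q)⁻¹ * t * (p * q)⁻¹⁻¹ = r)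
    (x : H c) (m : M) (n : N) :
    T.compatRight htr (congr μ ν) (tAct k T p q actM actN) (tCoact k T q ρM ρN r) (m ⊗ₜ n)
        (T.comulOf hc x)
      = lift ((T.tensorMul hs M N).compl₁₂
            (T.compatRight ht μ actM (ρM s) m ∘ₗ T.comulOf htp)
            (ρN r ∘ₗ actN.flip n)) (T.comulOf hd x) := by
  let Θ : H t ⊗[k] (H p ⊗[k] H q) →ₗ[k] (M ⊗[k] N) ⊗[k] H r :=
    T.compatRight htr (congr μ ν) (map₂ actM actN) (tCoact k T q ρM ρN r) (m ⊗ₜ n) ∘ₗ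
      LinearMap.rTensor _ (T.α t).toLinearMap
  have right (v : H t ⊗[k] H (p * q)) :
      T.compatRight htr (congr μ ν) (tAct k T p q actM actN) (tCoact k T q ρM ρN r) (m ⊗ₜ n) v
        = Θ (map (T.α t).symm.toLinearMap (T.comulOf rfl) v) := by
    induction v with
    | zero => simp
    | add v v' hv hv' => simp only [map_add, hv, hv']
    | tmul u a => simp [Θ, tAct, HomTC.comulOf, cst]
  have left (v : H d ⊗[k] H q) :
      lift ((T.tensorMul hs M N).compl₁₂ (T.compatRight ht μ actM (ρM s) m ∘ₗ T.comulOf htp)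
            (ρN r ∘ₗ actN.flip n)) v
        = Θ (TensorProduct.assoc k _ _ _
            (map (T.comulOf htp) (T.α q).symm.toLinearMap v)) := by
    induction v with
    | zero => simp
    | add v v' hv hv' => simp only [map_add, hv, hv']
    | tmul a b =>
      simp only [map_tmul, LinearEquiv.coe_coe, lift.tmul, LinearMap.compl₁₂_apply,
        LinearMap.comp_apply, LinearMap.flip_apply]
      generalize T.comulOf htp a = w
      induction w with
      | zero => simp
      | add w w' hw hw' => simp only [map_add, add_tmul, LinearMap.add_apply, hw, hw']
      | tmul u a =>
        simp only [assoc_tmul, T.compatRight_tmul, Θ, LinearMap.comp_apply,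
          LinearMap.rTensor_tmul, congr_symm_tmul, map₂_apply_tmul, map_tmul, tCoact_tmul hs,
          hN.act_α_symm, hN.ρ_μ_symm, LinearEquiv.coe_coe]
        generalize ρN r (actN b n) = Y
        generalize ρM s (actM a (μ.symm m)) = X
        induction X with
        | zero => simp
        | add x x' hx hx' => simp only [map_add, LinearMap.add_apply, hx, hx']
        | tmul m x =>
          induction Y with
          | zero => simp
          | add y y' hy hy' => simp only [map_add, hy, hy']
          | tmul n y =>
            simp [T.crossOf_α, T.mul_mul_α, T.crossOf_mul,
              T.crossOf_crossOf ht hs htr (mul_inv_rev p q)]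
  rw [right, left]
  exact congrArg _ (T.comulOf_comulOf hc rfl hd htp x)

theorem ydCompat_tensor (hM : IsYD k T p μ actM ρM) (hN : IsYD k T q ν actN ρN) :
    YDcompat k T (p * q) (congr μ ν) (tAct k T p q actM actN) (tCoact k T q ρM ρN) := by
  rw [ydCompat_iff]
  intro r t c h₁ h₂ h₃ x mn
  have hs : q⁻¹ * (q * r * q⁻¹) * q⁻¹⁻¹ = r := by group
  have ht : p⁻¹ * t * p⁻¹⁻¹ = q * r * q⁻¹ := by rw [← h₃]; group
  have hd : c = t * p * q := by rw [h₂, mul_assoc]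
  have hps : t * p = p * (q * r * q⁻¹) := by rw [← ht]; group
  induction mn with
  | zero => simp [HomTC.compatRight_zero]
  | add x x' hx hx' => rw [map_add, map_add, hx, hx', HomTC.compatRight_add, LinearMap.add_apply]
  | tmul m n =>
    have compat_M : (map₂ actM (T.mul _)).flip (ρM (q * r * q⁻¹) m) ∘ₗ T.comulOf hps
        = T.compatRight ht μ actM (ρM _) m ∘ₗ T.comulOf rfl :=
      LinearMap.ext fun y => ydCompat_iff.1 hM.compat _ t (t * p) hps rfl ht y m
    rw [tCoact_tmul hs, map₂_tAct_comulOf hN h₁ hd hps hs,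
      compatRight_tAct_comulOf hN h₂ hd rfl hs ht h₃, compat_M]

end TensorProduct

end TensorYD

/-- The tensor product of a `p`-Yetter-Drinfeld module and a
`q`-Yetter-Drinfeld module is a `pq`-Yetter-Drinfeld module. -/
theorem statement5 {k : Type*} [Field k] {G : Type*} [Group G] {H : G → Type*}
    [∀ p, AddCommGroup (H p)] [∀ p, Module k (H p)]
    (T : HomTC k G H) (p q : G)
    (M : Type*) [AddCommGroup M] [Module k M] (N : Type*) [AddCommGroup N] [Module k N]
    (μ : M ≃ₗ[k] M) (actM : H p →ₗ[k] M →ₗ[k] M) (ρM : ∀ r : G, M →ₗ[k] M ⊗[k] H r)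
    (ν : N ≃ₗ[k] N) (actN : H q →ₗ[k] N →ₗ[k] N) (ρN : ∀ r : G, N →ₗ[k] N ⊗[k] H r)
    (hM : IsYD k T p μ actM ρM) (hN : IsYD k T q ν actN ρN) :
    IsYD k T (p * q) (TensorProduct.congr μ ν)
      (tAct k T p q actM actN) (tCoact k T q ρM ρN) := by
  exact
    { act_act := tAct_tAct hM hN
      act_one := tAct_one hM hN
      μ_act := congr_tAct hM hN
      ρ_coassoc := fun a b => LinearMap.ext (tCoact_coassoc hM hN a b)
      ρ_counit := tCoact_counit hM hN
      ρ_μ := fun r => LinearMap.ext (tCoact_congr hM hN r)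
      compat := ydCompat_tensor hM hN }
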